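/- arXiv:1808.10370 — 3 statements merged into one kernel-verified Lean document; each statement's English description precedes it below -/
import Mathlib

section
/- Let (G,c) be a finite simple graph with cost function c : V(G) → ℝ≥0 and let u, u' ∈ V(G) be true twins. Let G' := G − u' and define c' : V(G') → ℝ≥0 by c'(u) := c(u) + c(u') and c'(v) := c(v) for v ∈ V(G'), v ≠ u. Then OPT(G,c) = OPT(G',c'). -/
/-- An induced `P₃` in `G`: three distinct vertices `a, b, c` such that
`ab` and `bc` are edges of `G` and `ac` is not an edge. -/
def IsInducedP3 {V : Type*} (G : SimpleGraph V) (a b c : V) : Prop :=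
  a ≠ c ∧ G.Adj a b ∧ G.Adj b c ∧ ¬ G.Adj a c

/-- A hitting set of `G`: a set of vertices intersecting every induced `P₃`. -/
def IsHittingSet {V : Type*} (G : SimpleGraph V) (X : Finset V) : Prop :=
  ∀ a b c : V, IsInducedP3 G a b c → a ∈ X ∨ b ∈ X ∨ c ∈ X

/-- `u` and `u'` are true twins in `G`: they are adjacent and every vertex
`w ∉ {u, u'}` is adjacent to `u` iff it is adjacent to `u'`. -/
def TrueTwins {V : Type*} (G : SimpleGraph V) (u u' : V) : Prop :=
  G.Adj u u' ∧ ∀ w : V, w ≠ u → w ≠ u' → (G.Adj w u ↔ G.Adj w u')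

theorem isInducedP3_induce_iff {V : Type*} (G : SimpleGraph V) (s : Set V) (a b c : s) :
    IsInducedP3 (G.induce s) a b c ↔ IsInducedP3 G (a : V) b c := by
  simp [IsInducedP3, Subtype.ext_iff]

theorem TrueTwins.symm {V : Type*} {G : SimpleGraph V} {u u' : V} (h : TrueTwins G u u') :
    TrueTwins G u' u :=
  ⟨h.1.symm, fun w hw hw' => (h.2 w hw' hw).symm⟩

/-- Replacing a vertex by its true twin preserves induced `P₃`s. -/
theorem TrueTwins.isInducedP3_ite {V : Type*} [DecidableEq V] {G : SimpleGraph V} {u u' : V}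
    (h : TrueTwins G u u') {a b c : V} (hP : IsInducedP3 G a b c) :
    IsInducedP3 G (if a = u' then u else a) (if b = u' then u else b)
      (if c = u' then u else c) := by
  obtain ⟨hadj, htw⟩ := h
  obtain ⟨hac, hab, hbc, hnac⟩ := hP
  have hau := htw a
  have hbu := htw b
  have hcu := htw c
  have hab' := hab.ne
  have hbc' := hbc.ne
  unfold IsInducedP3
  have hcomm := G.adj_comm
  clear htw
  grind

theorem sum_ite_add_eq {V : Type*} [DecidableEq V] (c : V → ℝ) (u : V) (d : ℝ) (Z : Finset V) :
    ∑ v ∈ Z, (if v = u then c u + d else c v) = ∑ v ∈ Z, c v + if u ∈ Z then d else 0 := by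
  rw [← Finset.sum_ite_eq' Z u fun _ => d, ← Finset.sum_add_distrib]
  refine Finset.sum_congr rfl fun v _ => ?_
  split_ifs with hv <;> simp [hv]

/-- A hitting set of `G − u'` extends to one of `G` by adding `u'` if `u` is chosen. -/
theorem TrueTwins.exists_isHittingSet_of_induce {V : Type*} [DecidableEq V] {G : SimpleGraph V}
    {u u' : V} (h : TrueTwins G u u') (c : V → ℝ) {X : Finset ({u'}ᶜ : Set V)}
    (hX : IsHittingSet (G.induce ({u'}ᶜ : Set V)) X) :
    ∃ Y : Finset V, IsHittingSet G Y ∧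
      ∑ v ∈ Y, c v = ∑ v ∈ X, (if (v : V) = u then c u + c u' else c (v : V)) := by
  have hne : u ≠ u' := h.1.ne
  set Z : Finset V := X.map (Function.Embedding.subtype _) with hZ
  have hu'Z : u' ∉ Z := by simp [hZ]
  have hsum : ∑ v ∈ X, (if (v : V) = u then c u + c u' else c (v : V)) =
      ∑ v ∈ Z, c v + if u ∈ Z then c u' else 0 := by
    rw [← sum_ite_add_eq, hZ, Finset.sum_map]
    rfl
  have hit : ∀ x y z, x ≠ u' → y ≠ u' → z ≠ u' → IsInducedP3 G x y z →
      x ∈ Z ∨ y ∈ Z ∨ z ∈ Z := by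
    intro x y z hx hy hz hP
    have := hX ⟨x, hx⟩ ⟨y, hy⟩ ⟨z, hz⟩ ((isInducedP3_induce_iff ..).2 hP)
    simpa [hZ, hx, hy, hz] using this
  refine ⟨if u ∈ Z then insert u' Z else Z, ?_, ?_⟩
  · have mem : ∀ v, v ∈ (if u ∈ Z then insert u' Z else Z) ↔ v ∈ Z ∨ (v = u' ∧ u ∈ Z) := by
      intro v
      split_ifs with hu <;> simp [hu, or_comm]
    intro x y z hP
    simp only [mem]
    have := hit _ _ _ (by grind) (by grind) (by grind) (h.isInducedP3_ite hP)
    clear_value Z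
    grind
  · rw [hsum]
    split_ifs with hu
    · rw [Finset.sum_insert hu'Z, add_comm]
    · simp

/-- A hitting set of `G` yields one of `G − u'` by dropping `u` unless both twins are chosen. -/
theorem TrueTwins.exists_isHittingSet_induce {V : Type*} [DecidableEq V] {G : SimpleGraph V}
    {u u' : V} (h : TrueTwins G u u') {c : V → ℝ} (hc : ∀ v, 0 ≤ c v) {X : Finset V}
    (hX : IsHittingSet G X) :
    ∃ Y : Finset ({u'}ᶜ : Set V), IsHittingSet (G.induce ({u'}ᶜ : Set V)) Y ∧
      ∑ v ∈ Y, (if (v : V) = u then c u + c u' else c (v : V)) ≤ ∑ v ∈ X, c v := by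
  classical
  have hne : u ≠ u' := h.1.ne
  set Z : Finset V := X.filter fun v => v ≠ u' ∧ (v = u → u' ∈ X) with hZ
  have memZ : ∀ v, v ∈ Z ↔ v ∈ X ∧ v ≠ u' ∧ (v = u → u' ∈ X) := by simp [hZ]
  have hit : ∀ x y z, x ≠ u' → y ≠ u' → z ≠ u' → IsInducedP3 G x y z →
      x ∈ Z ∨ y ∈ Z ∨ z ∈ Z := by
    intro x y z hx hy hz hP
    have h1 := hX _ _ _ hP
    have h2 := hX _ _ _ (h.symm.isInducedP3_ite hP)
    simp only [memZ]
    grind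
  refine ⟨Z.subtype (· ∈ ({u'}ᶜ : Set V)), ?_, ?_⟩
  · intro x y z hP
    simpa only [Finset.mem_subtype] using
      hit x y z x.2 y.2 z.2 ((isInducedP3_induce_iff ..).1 hP)
  · have hsum := Finset.sum_subtype_of_mem (p := (· ∈ ({u'}ᶜ : Set V))) (s := Z)
      (fun v => if v = u then c u + c u' else c v) (fun v hv => ((memZ v).1 hv).2.1)
    rw [hsum, sum_ite_add_eq]
    split_ifs with hu
    · have hu'Z : u' ∉ Z := by simp [memZ]
      rw [add_comm, ← Finset.sum_insert hu'Z]
      refine Finset.sum_le_sum_of_subset_of_nonneg ?_ fun v _ _ => hc v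
      exact Finset.insert_subset (((memZ u).1 hu).2.2 rfl) (Finset.filter_subset _ _)
    · rw [add_zero]
      exact Finset.sum_le_sum_of_subset_of_nonneg (Finset.filter_subset _ _) fun v _ _ => hc v

/-- Let `(G, c)` be a weighted graph with nonnegative costs and `u, u'` true twins.
Let `G' := G − u'` and transfer the cost of `u'` onto `u`:
`c'(u) := c(u) + c(u')` and `c'(v) := c(v)` otherwise.
Then `OPT(G, c) = OPT(G', c')`. -/
theorem stmt_9 {V : Type*} [Fintype V] [DecidableEq V] (G : SimpleGraph V)
    (c : V → ℝ) (hc : ∀ v, 0 ≤ c v) (u u' : V) (h : TrueTwins G u u') :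
    sInf {r : ℝ | ∃ X : Finset V, IsHittingSet G X ∧ ∑ v ∈ X, c v = r} =
    sInf {r : ℝ | ∃ X : Finset ({u'}ᶜ : Set V),
        IsHittingSet (G.induce ({u'}ᶜ : Set V)) X ∧
        ∑ v ∈ X, (if (v : V) = u then c u + c u' else c (v : V)) = r} := by
  have hcost : ∀ v, 0 ≤ if v = u then c u + c u' else c v := fun v => by
    split_ifs
    exacts [add_nonneg (hc u) (hc u'), hc v]
  apply le_antisymm
  · refine le_csInf ⟨_, Finset.univ, fun a _ _ _ => Or.inl (Finset.mem_univ a), rfl⟩ ?_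
    rintro _ ⟨X, hX, rfl⟩
    obtain ⟨Y, hY, hYX⟩ := h.exists_isHittingSet_of_induce c hX
    refine csInf_le ⟨0, ?_⟩ ⟨Y, hY, hYX⟩
    rintro _ ⟨Z, -, rfl⟩
    exact Finset.sum_nonneg fun v _ => hc v
  · refine le_csInf ⟨_, Finset.univ, fun a _ _ _ => Or.inl (Finset.mem_univ a), rfl⟩ ?_
    rintro _ ⟨X, hX, rfl⟩
    obtain ⟨Y, hY, hYX⟩ := h.exists_isHittingSet_induce hc hX
    refine le_trans (csInf_le ⟨0, ?_⟩ ⟨Y, hY, rfl⟩) hYX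
    rintro _ ⟨Z, -, rfl⟩
    exact Finset.sum_nonneg fun v _ => hcost v
end

section
/- Let H be a finite simple graph whose vertex set is partitioned into a clique C and a distinguishing set D for C. Then there exists a weight function c_H : V(H) → ℤ≥0 such that c_H(v) = 1 for all v ∈ C, Σ_{v∈D} c_H(v) = |C| − 1, and every set X ⊆ V(H) that intersects each distinguishing P3 of H has weight c_H(X) ≥ |C| − 1. In particular, OPT(H,c_H) ≥ |C| − 1. -/
/-- `w` distinguishes the edge `uv`: `w` is adjacent to exactly one of `u`, `v`. -/
def Distinguishes {V : Type*} (G : SimpleGraph V) (w u v : V) : Prop :=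
  Xor' (G.Adj w u) (G.Adj w v)

/-- `u` and `v` are true twins in the subgraph of `G` induced on `S`. -/
def TrueTwinsIn {V : Type*} (G : SimpleGraph V) (S : Set V) (u v : V) : Prop :=
  G.Adj u v ∧ ∀ w ∈ S, w ≠ u → w ≠ v → (G.Adj w u ↔ G.Adj w v)

/-- `D` is a distinguishing set for `S`. -/
def DistinguishingSet {V : Type*} (G : SimpleGraph V) (S D : Set V) : Prop :=
  Disjoint S D ∧ ∀ u ∈ S, ∀ v ∈ S, G.Adj u v → TrueTwinsIn G S u v →
    ∃ w ∈ D, Distinguishes G w u v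

open Classical in
/-- If the predicates `r w`, `w ∈ D`, separate the points of `C`, then `D` carries natural weights of
total `|C| - 1` such that the predicates that are not constant on `S` have total weight at least
`|S| - 1`, for every `S ⊆ C`. -/
theorem exists_weight_of_separating {α β : Type*} (D : Finset β) (r : β → α → Prop)
    (C : Finset α)
    (hsep : ∀ u ∈ C, ∀ v ∈ C, u ≠ v → ∃ w ∈ D, Xor (r w u) (r w v)) :
    ∃ c : β → ℕ, ∑ w ∈ D, c w = C.card - 1 ∧
      ∀ S ⊆ C, S.card - 1 ≤ ∑ w ∈ D with ∃ u ∈ S, ∃ v ∈ S, r w u ∧ ¬ r w v, c w := by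
  induction C using Finset.strongInduction with
  | H C ih =>
  by_cases hcard : C.card ≤ 1
  · refine ⟨fun _ => 0, by simp; omega, fun S hS => ?_⟩
    have := Finset.card_le_card hS
    omega
  obtain ⟨u, hu, v, hv, huv⟩ := Finset.one_lt_card.1 (not_le.1 hcard)
  obtain ⟨w₀, hw₀, hx⟩ := hsep u hu v hv huv
  obtain ⟨a, ha, b, hb, hra, hrb⟩ : ∃ a ∈ C, ∃ b ∈ C, r w₀ a ∧ ¬ r w₀ b := by
    rcases hx with ⟨h, h'⟩ | ⟨h, h'⟩
    exacts [⟨u, hu, v, hv, h, h'⟩, ⟨v, hv, u, hu, h, h'⟩]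
  set A := C.filter (fun x => r w₀ x) with hA
  set B := C.filter (fun x => ¬ r w₀ x) with hB
  have hAC : A ⊂ C := Finset.filter_ssubset.2 ⟨b, hb, hrb⟩
  have hBC : B ⊂ C := Finset.filter_ssubset.2 ⟨a, ha, not_not.2 hra⟩
  obtain ⟨cA, hcA, hSA⟩ := ih A hAC fun x hx y hy => hsep x (hAC.1 hx) y (hAC.1 hy)
  obtain ⟨cB, hcB, hSB⟩ := ih B hBC fun x hx y hy => hsep x (hBC.1 hx) y (hBC.1 hy)
  have hcardAB : A.card + B.card = C.card := Finset.card_filter_add_card_filter_not _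
  have hApos : 0 < A.card := Finset.card_pos.2 ⟨a, by simp [hA, ha, hra]⟩
  have hBpos : 0 < B.card := Finset.card_pos.2 ⟨b, by simp [hB, hb, hrb]⟩
  refine ⟨fun w => cA w + cB w + if w = w₀ then 1 else 0, ?_, fun S hS => ?_⟩
  · rw [Finset.sum_add_distrib, Finset.sum_add_distrib, hcA, hcB, Finset.sum_ite_eq', if_pos hw₀]
    omega
  have hmono : ∀ (c : β → ℕ) (T : Finset α), T ⊆ S →
      ∑ w ∈ D with ∃ u ∈ T, ∃ v ∈ T, r w u ∧ ¬ r w v, c w ≤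
        ∑ w ∈ D with ∃ u ∈ S, ∃ v ∈ S, r w u ∧ ¬ r w v, c w := by
    intro c T hT
    refine Finset.sum_le_sum_of_subset (Finset.monotone_filter_right _ ?_)
    rintro w _ ⟨x, hx, y, hy, h⟩
    exact ⟨x, hT hx, y, hT hy, h⟩
  have h₁ := (hSA _ (Finset.filter_subset_filter _ hS)).trans
    (hmono cA _ (Finset.filter_subset (fun x => r w₀ x) S))
  have h₂ := (hSB _ (Finset.filter_subset_filter _ hS)).trans
    (hmono cB _ (Finset.filter_subset (fun x => ¬ r w₀ x) S))
  have hcardS : (S.filter (fun x => r w₀ x)).card + (S.filter (fun x => ¬ r w₀ x)).card = S.card :=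
    Finset.card_filter_add_card_filter_not _
  rw [Finset.sum_add_distrib, Finset.sum_add_distrib, Finset.sum_ite_eq']
  split_ifs with hw
  · omega
  · have : (S.filter (fun x => r w₀ x)).card = 0 ∨ (S.filter (fun x => ¬ r w₀ x)).card = 0 := by
      by_contra! hne
      obtain ⟨x, hx⟩ := Finset.card_ne_zero.1 hne.1
      obtain ⟨y, hy⟩ := Finset.card_ne_zero.1 hne.2
      rw [Finset.mem_filter] at hx hy
      exact hw (Finset.mem_filter.2 ⟨hw₀, x, hx.1, y, hy.1, hx.2, hy.2⟩)
    omega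

/-- A hitting set meets every induced `P₃` formed by an edge and a vertex distinguishing it. -/
theorem IsHittingSet.mem_of_distinguishes {V : Type*} {G : SimpleGraph V} {X : Finset V}
    (hX : IsHittingSet G X) {u v w : V} (huv : G.Adj u v) (hwu : w ≠ u) (hwv : w ≠ v)
    (hw : Distinguishes G w u v) : u ∈ X ∨ v ∈ X ∨ w ∈ X := by
  rcases hw with ⟨h, h'⟩ | ⟨h, h'⟩
  · have := hX w u v ⟨hwv, h, huv, h'⟩
    tauto
  · have := hX w v u ⟨hwu, h, huv.symm, h'⟩
    tauto

/-- Let `H` be a graph whose vertex set is partitioned into a clique `C` and a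
distinguishing set `D` for `C`.  Then there is a weight function
`c_H : V(H) → ℤ≥0` with `c_H(v) = 1` on `C`, `∑_{v ∈ D} c_H(v) = |C| − 1`, and
such that every set `X` hitting each distinguishing `P₃` has weight
`c_H(X) ≥ |C| − 1`.  In particular every hitting set of `H` has weight
at least `|C| − 1`, i.e. `OPT(H, c_H) ≥ |C| − 1`. -/
theorem stmt_11 {V : Type*} [Fintype V] [DecidableEq V] (H : SimpleGraph V)
    (C D : Finset V) (hpart : C ∪ D = Finset.univ) (hdisj : Disjoint C D)
    (hC : H.IsClique (C : Set V))
    (hD : DistinguishingSet H (C : Set V) (D : Set V)) :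
    ∃ cH : V → ℕ,
      (∀ v ∈ C, cH v = 1) ∧
      (∑ v ∈ D, cH v = C.card - 1) ∧
      (∀ X : Finset V,
        (∀ u v w : V, u ∈ C → v ∈ C → H.Adj u v → w ∈ D →
          Distinguishes H w u v → u ∈ X ∨ v ∈ X ∨ w ∈ X) →
        C.card - 1 ≤ ∑ v ∈ X, cH v) ∧
      (∀ X : Finset V, IsHittingSet H X → C.card - 1 ≤ ∑ v ∈ X, cH v) := by
  classical
  obtain ⟨c, hc, hS⟩ := exists_weight_of_separating D H.Adj C fun u hu v hv huv =>
    hD.2 u hu v hv (hC hu hv huv) ⟨hC hu hv huv, fun w hw hwu hwv =>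
      iff_of_true (hC hw hu hwu) (hC hw hv hwv)⟩
  have hDC : ∀ w ∈ D, w ∉ C := fun w hw hw' => Finset.disjoint_left.1 hdisj hw' hw
  have key : ∀ X : Finset V,
      (∀ u v w : V, u ∈ C → v ∈ C → H.Adj u v → w ∈ D →
        Distinguishes H w u v → u ∈ X ∨ v ∈ X ∨ w ∈ X) →
      C.card - 1 ≤ ∑ v ∈ X, if v ∈ C then 1 else c v := by
    intro X hX
    have hsplit : (D.filter fun w => ∃ u ∈ C \ X, ∃ v ∈ C \ X, H.Adj w u ∧ ¬ H.Adj w v) ⊆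
        X.filter (fun v => v ∉ C) := by
      intro w hw
      obtain ⟨hwD, u, hu, v, hv, hwu, hwv⟩ := Finset.mem_filter.1 hw
      rw [Finset.mem_sdiff] at hu hv
      have huv : u ≠ v := by rintro rfl; exact hwv hwu
      have := hX u v w hu.1 hv.1 (hC hu.1 hv.1 huv) hwD (Or.inl ⟨hwu, hwv⟩)
      exact Finset.mem_filter.2 ⟨by tauto, hDC w hwD⟩
    have h₁ := (hS (C \ X) Finset.sdiff_subset).trans (Finset.sum_le_sum_of_subset hsplit)
    have h₂ : (C \ X).card + (C ∩ X).card = C.card := Finset.card_sdiff_add_card_inter C X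
    rw [Finset.sum_ite, Finset.sum_const, smul_eq_mul, mul_one, Finset.filter_mem_eq_inter,
      Finset.inter_comm]
    omega
  refine ⟨fun v => if v ∈ C then 1 else c v, fun v hv => if_pos hv, ?_, key, fun X hX => ?_⟩
  · rw [← hc]
    exact Finset.sum_congr rfl fun w hw => if_neg (hDC w hw)
  · exact key X fun u v w hu hv huv hw hd => hX.mem_of_distinguishes huv
      (fun h => hDC w hw (h ▸ hu)) (fun h => hDC w hw (h ▸ hv)) hd
end

section
/- Let G be a twin-free finite simple graph, let C be a clique of size 5 in G, and let D ⊆ V(G) be a distinguishing set for C. Then there exists a weight function c_H on the induced subgraph H := G[C ∪ D] such that (H,c_H) is 9/4-good in G; moreover one can take c_H with Σ_{v∈V(H)} c_H(v) = 9 and OPT(H,c_H) ≥ 4, so that Σ_{v∈V(H)} c_H(v) ≤ (9/4)·OPT(H,c_H). -/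
/-- `X` is a hitting set of the subgraph of `G` induced on `S`. -/
def HitsIn {V : Type*} (G : SimpleGraph V) (S : Finset V) (X : Finset V) : Prop :=
  ∀ a b c : V, a ∈ S → b ∈ S → c ∈ S → IsInducedP3 G a b c →
    a ∈ X ∨ b ∈ X ∨ c ∈ X

/-- `OPT(G[S], c)`: the minimum weight of a hitting set of the subgraph of `G`
induced on `S`. -/
noncomputable def OPTIn {V : Type*} [Fintype V] (G : SimpleGraph V) (S : Finset V)
    (c : V → ℝ) : ℝ :=
  sInf {r : ℝ | ∃ X : Finset V, X ⊆ S ∧ HitsIn G S X ∧ ∑ v ∈ X, c v = r}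

/-- A clique `C` whose edges are all distinguished by vertices of `D` carries a weight function
of total weight `2 * #C - 1`, equal to `1` on `C` and supported on `C ∪ D`, for which every
hitting set of `G[C ∪ D]` has weight at least `#C - 1`. -/
theorem exists_weight_of_isClique {V : Type*} [Fintype V] [DecidableEq V] (G : SimpleGraph V)
    (D : Finset V) (C : Finset V) (hne : C.Nonempty) (hclique : G.IsClique (C : Set V))
    (hdisj : Disjoint C D)
    (hdist : ∀ u ∈ C, ∀ v ∈ C, u ≠ v → ∃ w ∈ D, Distinguishes G w u v) :
    ∃ c : V → ℕ, (∀ v ∈ C, c v = 1) ∧ (∀ v ∉ C ∪ D, c v = 0) ∧ ∑ v, c v + 1 = 2 * C.card ∧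
      ∀ X : Finset V, HitsIn G (C ∪ D) X → C.card ≤ ∑ v ∈ X, c v + 1 := by
  classical
  induction C using Finset.strongInduction with
  | H C ih =>
  by_cases hcard : C.card = 1
  · obtain ⟨x, rfl⟩ := Finset.card_eq_one.mp hcard
    refine ⟨fun v => if v = x then 1 else 0, by simp, ?_, by simp, by simp⟩
    intro v hv
    simp only [Finset.mem_union, Finset.mem_singleton, not_or] at hv
    simp [hv.1]
  · have hcard' : 1 < C.card := by have := hne.card_pos; omega
    obtain ⟨u, hu, v, hv, huv⟩ := Finset.one_lt_card.mp hcard'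
    obtain ⟨w, hwD, hw⟩ := hdist u hu v hv huv
    have hwC : w ∉ C := Finset.disjoint_right.mp hdisj hwD
    set A := C.filter (fun x => G.Adj w x) with hA
    set B := C.filter (fun x => ¬ G.Adj w x) with hB
    have hAC : A ⊆ C := Finset.filter_subset _ _
    have hBC : B ⊆ C := Finset.filter_subset _ _
    have hAB : A.card + B.card = C.card := Finset.card_filter_add_card_filter_not _
    have hAne : A.Nonempty := by
      rcases hw with ⟨h, -⟩ | ⟨h, -⟩
      · exact ⟨u, Finset.mem_filter.mpr ⟨hu, h⟩⟩
      · exact ⟨v, Finset.mem_filter.mpr ⟨hv, h⟩⟩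
    have hBne : B.Nonempty := by
      rcases hw with ⟨-, h⟩ | ⟨-, h⟩
      · exact ⟨v, Finset.mem_filter.mpr ⟨hv, h⟩⟩
      · exact ⟨u, Finset.mem_filter.mpr ⟨hu, h⟩⟩
    have hApos := hAne.card_pos
    have hBpos := hBne.card_pos
    have weight_of_ssubset : ∀ E ⊆ C, E.Nonempty → E.card < C.card →
        ∃ c : V → ℕ, (∀ v ∈ E, c v = 1) ∧ (∀ v ∉ E ∪ D, c v = 0) ∧
          ∑ v, c v + 1 = 2 * E.card ∧
          ∀ X : Finset V, HitsIn G (C ∪ D) X → E.card ≤ ∑ v ∈ X, c v + 1 := by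
      intro E hEC hE hlt
      obtain ⟨c, h1, h0, hsum, hhit⟩ := ih E
        (Finset.ssubset_iff_subset_ne.mpr ⟨hEC, by rintro rfl; exact hlt.false⟩) hE
        (hclique.subset (by exact_mod_cast hEC)) (Finset.disjoint_of_subset_left hEC hdisj)
        (fun x hx y hy => hdist x (hEC hx) y (hEC hy))
      have hsub : E ∪ D ⊆ C ∪ D := Finset.union_subset_union_left hEC
      exact ⟨c, h1, h0, hsum, fun X hX => hhit X fun x y z hx hy hz =>
        hX x y z (hsub hx) (hsub hy) (hsub hz)⟩
    obtain ⟨cA, hA1, hA0, hAsum, hAhit⟩ := weight_of_ssubset A hAC hAne (by omega)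
    obtain ⟨cB, hB1, hB0, hBsum, hBhit⟩ := weight_of_ssubset B hBC hBne (by omega)
    refine ⟨fun x => cA x + cB x + if x = w then 1 else 0, ?_, ?_, ?_, ?_⟩
    · intro x hx
      have hxD : x ∉ D := Finset.disjoint_left.mp hdisj hx
      have hxw : x ≠ w := by rintro rfl; exact hwC hx
      by_cases h : G.Adj w x
      · simp [hA1 x (by simp [hA, hx, h]), hB0 x (by simp [hB, hxD, h]), hxw]
      · simp [hA0 x (by simp [hA, hxD, h]), hB1 x (by simp [hB, hx, h]), hxw]
    · intro x hx
      simp only [Finset.mem_union, not_or] at hx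
      have hxw : x ≠ w := by rintro rfl; exact hx.2 hwD
      simp [hA0 x (by simp [hA, hx]), hB0 x (by simp [hB, hx]), hxw]
    · simp only [Finset.sum_add_distrib, Finset.sum_ite_eq', Finset.mem_univ, if_true]
      omega
    · intro X hX
      have hAX := hAhit X hX
      have hBX := hBhit X hX
      simp only [Finset.sum_add_distrib, Finset.sum_ite_eq']
      by_cases hwX : w ∈ X
      · simp only [hwX, if_true]
        omega
      · have hor : A ⊆ X ∨ B ⊆ X := by
          by_contra! hcon
          obtain ⟨a, ha, haX⟩ := Finset.not_subset.mp hcon.1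
          obtain ⟨b, hb, hbX⟩ := Finset.not_subset.mp hcon.2
          obtain ⟨haC, hwa⟩ := Finset.mem_filter.mp ha
          obtain ⟨hbC, hwb⟩ := Finset.mem_filter.mp hb
          have hab : a ≠ b := by rintro rfl; exact hwb hwa
          have hwb' : w ≠ b := by rintro rfl; exact hwC hbC
          rcases hX w a b (Finset.mem_union_right _ hwD) (Finset.mem_union_left _ haC)
            (Finset.mem_union_left _ hbC) ⟨hwb', hwa, hclique haC hbC hab, hwb⟩ with h | h | h
          exacts [hwX h, haX h, hbX h]
        have card_le : ∀ (E : Finset V) (c : V → ℕ), (∀ v ∈ E, c v = 1) → E ⊆ X →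
            E.card ≤ ∑ v ∈ X, c v := fun E c h1 hEX => by
          rw [Finset.card_eq_sum_ones, ← Finset.sum_congr rfl h1]
          exact Finset.sum_le_sum_of_subset hEX
        rcases hor with h | h
        · have := card_le A cA hA1 h
          omega
        · have := card_le B cB hB1 h
          omega

/-- Let `G` be a twin-free graph, `C` a 5-clique in `G`, and `D` a distinguishing
set for `C`.  Then the induced subgraph `H := G[C ∪ D]` is `9/4`-good in `G`:
there is a weight function `c_H` such that for every inclusionwise minimal
hitting set `X` of `G`, `∑_{v ∈ X ∩ V(H)} c_H(v) ≤ (9/4)·OPT(H, c_H)`;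
moreover one can take `c_H` with `∑_{v ∈ V(H)} c_H(v) = 9` and
`OPT(H, c_H) ≥ 4` (so that `∑_{v ∈ V(H)} c_H(v) ≤ (9/4)·OPT(H, c_H)`). -/
theorem stmt_13 {V : Type*} [Fintype V] [DecidableEq V] (G : SimpleGraph V)
    (htwinfree : ∀ u u' : V, ¬ TrueTwins G u u')
    (C D : Finset V) (hC5 : C.card = 5) (hclique : G.IsClique (C : Set V))
    (hD : DistinguishingSet G (C : Set V) (D : Set V)) :
    ∃ cH : V → ℕ,
      (∀ X : Finset V, IsHittingSet G X →
        (∀ Y : Finset V, Y ⊆ X → IsHittingSet G Y → Y = X) →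
        (∑ v ∈ X ∩ (C ∪ D), (cH v : ℝ)) ≤
          (9 / 4) * OPTIn G (C ∪ D) (fun v => (cH v : ℝ))) ∧
      (∑ v ∈ C ∪ D, (cH v : ℝ)) = 9 ∧
      4 ≤ OPTIn G (C ∪ D) (fun v => (cH v : ℝ)) := by
  obtain ⟨c, -, h0, hsum, hhit⟩ := exists_weight_of_isClique G D C
    (Finset.card_pos.mp (by omega)) hclique (by exact_mod_cast hD.1) (by
      intro u hu v hv huv
      refine hD.2 u hu v hv (hclique hu hv huv) ⟨hclique hu hv huv, fun w hw hwu hwv => ?_⟩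
      exact iff_of_true (hclique hw hu hwu) (hclique hw hv hwv))
  have htotal : ∑ v ∈ C ∪ D, (c v : ℝ) = 9 := by
    have hsub : ∑ v ∈ C ∪ D, c v = ∑ v, c v :=
      Finset.sum_subset (Finset.subset_univ _) fun v _ hv => h0 v hv
    have : ∑ v ∈ C ∪ D, c v = 9 := by omega
    exact_mod_cast this
  have hopt : 4 ≤ OPTIn G (C ∪ D) (fun v => (c v : ℝ)) := by
    refine le_csInf ⟨_, C ∪ D, subset_rfl, fun a _ _ ha _ _ _ => Or.inl ha, rfl⟩ ?_
    rintro r ⟨X, -, hX, rfl⟩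
    have := hhit X hX
    have : 4 ≤ ∑ v ∈ X, c v := by omega
    show (4 : ℝ) ≤ ∑ v ∈ X, (c v : ℝ)
    exact_mod_cast this
  refine ⟨c, fun X _ _ => ?_, htotal, hopt⟩
  have hle : ∑ v ∈ X ∩ (C ∪ D), (c v : ℝ) ≤ ∑ v ∈ C ∪ D, (c v : ℝ) :=
    Finset.sum_le_sum_of_subset_of_nonneg Finset.inter_subset_right fun _ _ _ => by positivity
  linarith
end
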